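/- For the elephant random walk remembering only the most recent step, the strong law of large numbers holds: S_n/n → 0 almost surely as n → ∞. -/

import Mathlib

open MeasureTheory ProbabilityTheory Filter Topology

noncomputable section

/-- The σ-algebra generated by the steps `X 1, …, X n`. -/
def sigmaUpTo {Ω : Type*} (X : ℕ → Ω → ℝ) (n : ℕ) : MeasurableSpace Ω :=
  ⨆ i ∈ Finset.Icc 1 n, MeasurableSpace.comap (X i) inferInstance

/-- The σ-algebra generated by all the steps `X 1, X 2, …`. -/
def sigmaAll {Ω : Type*} (X : ℕ → Ω → ℝ) : MeasurableSpace Ω :=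
  ⨆ i ∈ Set.Ici 1, MeasurableSpace.comap (X i) inferInstance

/-- The partial sum `X 1 + ⋯ + X n` of the walk. -/
def partialSum {Ω : Type*} (X : ℕ → Ω → ℝ) (n : ℕ) (ω : Ω) : ℝ :=
  ∑ k ∈ Finset.Icc 1 n, X k ω

/-- Convergence in distribution of the random variables `f n` to the law `ν`,
expressed as weak convergence tested against bounded continuous functions. -/
def TendstoInDistribution {Ω : Type*} [MeasurableSpace Ω] (μ : Measure Ω)
    (f : ℕ → Ω → ℝ) (ν : Measure ℝ) : Prop :=
  ∀ g : BoundedContinuousFunction ℝ ℝ,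
    Tendsto (fun n => ∫ ω, g (f n ω) ∂μ) atTop (𝓝 (∫ x, g x ∂ν))

lemma ae_tendsto_zero_of_summable_integral {Ω : Type*} [MeasurableSpace Ω] {μ : Measure Ω}
    {f : ℕ → Ω → ℝ} {b : ℕ → ℝ} (hf : ∀ n, Measurable (f n)) (hf0 : ∀ n ω, 0 ≤ f n ω)
    (hint : ∀ n, Integrable (f n) μ) (hb : Summable b) (hfb : ∀ n, ∫ ω, f n ω ∂μ ≤ b n) :
    ∀ᵐ ω ∂μ, Tendsto (fun n => f n ω) atTop (𝓝 0) := by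
  have hsum : ∫⁻ ω, ∑' n, ENNReal.ofReal (f n ω) ∂μ ≠ ⊤ := by
    rw [lintegral_tsum fun n => (hf n).ennreal_ofReal.aemeasurable]
    refine ne_top_of_le_ne_top hb.tsum_ofReal_ne_top (ENNReal.tsum_le_tsum fun n => ?_)
    rw [← ofReal_integral_eq_lintegral_ofReal (hint n) (.of_forall (hf0 n))]
    exact ENNReal.ofReal_le_ofReal (hfb n)
  filter_upwards [ae_lt_top (Measurable.tsum fun n => (hf n).ennreal_ofReal) hsum]
    with ω hω
  have h := (ENNReal.tendsto_toReal ENNReal.zero_ne_top).comp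
    (ENNReal.tendsto_atTop_zero_of_tsum_ne_top hω.ne)
  simpa [Function.comp_def, ENNReal.toReal_ofReal (hf0 _ ω)] using h

section LastStepWalk

lemma partialSum_succ {Ω : Type*} (X : ℕ → Ω → ℝ) (n : ℕ) (ω : Ω) :
    partialSum X (n + 1) ω = partialSum X n ω + X (n + 1) ω :=
  Finset.sum_Icc_succ_top (by omega) _

lemma sigmaUpTo_le {Ω : Type*} [MeasurableSpace Ω] {X : ℕ → Ω → ℝ}
    (hX : ∀ i, Measurable (X i)) (n : ℕ) : sigmaUpTo X n ≤ ‹MeasurableSpace Ω› :=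
  iSup₂_le fun i _ => (hX i).comap_le

lemma measurable_sigmaUpTo {Ω : Type*} (X : ℕ → Ω → ℝ) {i n : ℕ} (hi : i ∈ Finset.Icc 1 n) :
    Measurable[sigmaUpTo X n] (X i) :=
  measurable_iff_comap_le.2
    (le_iSup₂ (f := fun i (_ : i ∈ Finset.Icc 1 n) => MeasurableSpace.comap (X i) _) i hi)

lemma measurable_partialSum_sigmaUpTo {Ω : Type*} (X : ℕ → Ω → ℝ) (n : ℕ) :
    Measurable[sigmaUpTo X n] (partialSum X n) :=
  Finset.measurable_fun_sum _ fun _ hi => measurable_sigmaUpTo X hi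

lemma tendsto_partialSum_div {Ω : Type*} {X : ℕ → Ω → ℝ} {ω : Ω}
    (hX : ∀ i, 1 ≤ i → -1 ≤ X i ω)
    (h : Tendsto (fun k : ℕ => (partialSum X ((k + 1) ^ 2) ω / ((k + 1) ^ 2 : ℕ)) ^ 2)
      atTop (𝓝 0)) :
    Tendsto (fun n : ℕ => partialSum X n ω / n) atTop (𝓝 0) := by
  have hsq : Tendsto (fun k : ℕ => partialSum X ((k + 1) ^ 2) ω / ((k + 1) ^ 2 : ℕ))
      atTop (𝓝 0) := by
    have := h.sqrt
    simp only [Real.sqrt_sq_eq_abs, Real.sqrt_zero] at this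
    exact (tendsto_zero_iff_abs_tendsto_zero _).2 this
  have hmono : Monotone fun n : ℕ => partialSum X n ω + n := by
    refine monotone_nat_of_le_succ fun n => ?_
    rw [partialSum_succ]
    push_cast
    linarith [hX (n + 1) (by omega)]
  have hsub : Tendsto
      (fun k : ℕ => (partialSum X ((k + 1) ^ 2) ω + ((k + 1) ^ 2 : ℕ)) / ((k + 1) ^ 2 : ℕ))
      atTop (𝓝 1) := by
    have := hsq.add_const 1
    rw [zero_add] at this
    refine this.congr fun k => ?_
    have : (((k + 1) ^ 2 : ℕ) : ℝ) ≠ 0 := by positivity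
    field_simp
  have hgrowth (r : ℝ) (hr : 1 < r) :
      ∀ᶠ k : ℕ in atTop, (((k + 1 + 1) ^ 2 : ℕ) : ℝ) ≤ r * ((k + 1) ^ 2 : ℕ) := by
    filter_upwards [eventually_ge_atTop ⌈3 / (r - 1)⌉₊] with k hk
    have hk' : 3 / (r - 1) ≤ k := Nat.ceil_le.1 hk
    rw [div_le_iff₀ (by linarith)] at hk'
    push_cast
    nlinarith [mul_nonneg (Nat.cast_nonneg (α := ℝ) k) (sub_nonneg.2 hk')]
  have hlim := tendsto_div_of_monotone_of_exists_subseq_tendsto_div _ 1 hmono fun r hr =>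
    ⟨fun k => (k + 1) ^ 2, hgrowth r hr,
      (tendsto_pow_atTop two_ne_zero).comp (tendsto_add_atTop_nat 1), hsub⟩
  have := hlim.sub_const 1
  rw [sub_self] at this
  refine this.congr' ?_
  filter_upwards [eventually_ge_atTop 1] with n hn
  have : (n : ℝ) ≠ 0 := by positivity
  field_simp
  ring

variable {Ω : Type*} [MeasurableSpace Ω] {μ : Measure Ω} {a : ℝ} {X : ℕ → Ω → ℝ}

lemma memLp_partialSum (hX : ∀ i, 1 ≤ i → MemLp (X i) 2 μ) (n : ℕ) :
    MemLp (partialSum X n) 2 μ :=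
  memLp_finsetSum _ fun i hi => hX i (Finset.mem_Icc.1 hi).1

variable [IsProbabilityMeasure μ]

/-- Multiplying by a square-integrable function of the past, the next step may be replaced by
its conditional expectation. -/
lemma integral_mul_step {n : ℕ} {W : Ω → ℝ} (hXmeas : ∀ i, Measurable (X i))
    (hX : MemLp (X (n + 1)) 2 μ) (hW : MemLp W 2 μ) (hWmeas : Measurable[sigmaUpTo X n] W)
    (hcond : μ[X (n + 1) | sigmaUpTo X n] =ᵐ[μ] fun ω => a * X n ω) :
    ∫ ω, W ω * X (n + 1) ω ∂μ = ∫ ω, W ω * (a * X n ω) ∂μ := by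
  rw [← integral_condExp (sigmaUpTo_le hXmeas n)]
  refine integral_congr_ae ?_
  refine (condExp_mul_of_stronglyMeasurable_left hWmeas.stronglyMeasurable
    (hW.integrable_mul hX) (hX.integrable one_le_two)).trans ?_
  filter_upwards [hcond] with ω hω
  simp [hω]

/-- The process `(1 - a) Sₙ + a Xₙ` is a martingale with increments bounded by `2`, so its second
moment grows at most linearly. -/
lemma integral_martingale_sq_le (ha : |a| ≤ 1) (hXmeas : ∀ i, Measurable (X i))
    (hval : ∀ i, 1 ≤ i → ∀ᵐ ω ∂μ, X i ω = 1 ∨ X i ω = -1)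
    (hX : ∀ i, 1 ≤ i → MemLp (X i) 2 μ)
    (hcond : ∀ n, 1 ≤ n → μ[X (n + 1) | sigmaUpTo X n] =ᵐ[μ] fun ω => a * X n ω)
    {n : ℕ} (hn : 1 ≤ n) :
    ∫ ω, ((1 - a) * partialSum X n ω + a * X n ω) ^ 2 ∂μ ≤ 4 * (n : ℝ) := by
  obtain ⟨ha₁, ha₂⟩ := abs_le.1 ha
  have hWL (n : ℕ) (hn : 1 ≤ n) :
      MemLp (fun ω => (1 - a) * partialSum X n ω + a * X n ω) 2 μ :=
    ((memLp_partialSum hX n).const_mul _).add ((hX n hn).const_mul _)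
  induction n, hn using Nat.le_induction with
  | base =>
    have : ∫ ω, ((1 - a) * partialSum X 1 ω + a * X 1 ω) ^ 2 ∂μ = ∫ _, (1 : ℝ) ∂μ := by
      refine integral_congr_ae ?_
      filter_upwards [hval 1 le_rfl] with ω hω
      rw [partialSum, Finset.Icc_self, Finset.sum_singleton]
      rcases hω with h | h <;> rw [h] <;> ring
    rw [this]
    norm_num
  | succ n hn ih =>
    have hWmeas : Measurable[sigmaUpTo X n]
        (fun ω => (1 - a) * partialSum X n ω + a * X n ω) :=
      ((measurable_partialSum_sigmaUpTo X n).const_mul _).add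
        ((measurable_sigmaUpTo X (Finset.mem_Icc.2 ⟨hn, le_rfl⟩)).const_mul _)
    set W : Ω → ℝ := fun ω => (1 - a) * partialSum X n ω + a * X n ω with hW
    have horth : ∫ ω, W ω * X (n + 1) ω ∂μ = ∫ ω, W ω * (a * X n ω) ∂μ :=
      integral_mul_step hXmeas (hX (n + 1) (by omega)) (hWL n hn) hWmeas (hcond n hn)
    have hi₁ : Integrable (fun ω => W ω ^ 2) μ := (hWL n hn).integrable_sq
    have hi₂ : Integrable (fun ω => W ω * X (n + 1) ω) μ :=
      (hWL n hn).integrable_mul (hX (n + 1) (by omega))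
    have hi₃ : Integrable (fun ω => W ω * (a * X n ω)) μ :=
      (hWL n hn).integrable_mul ((hX n hn).const_mul a)
    have hi₄ : Integrable (fun ω => 2 * (W ω * X (n + 1) ω - W ω * (a * X n ω))) μ :=
      (hi₂.sub hi₃).const_mul 2
    have hi₅ : Integrable
        (fun ω => W ω ^ 2 + 2 * (W ω * X (n + 1) ω - W ω * (a * X n ω))) μ := hi₁.add hi₄
    calc ∫ ω, ((1 - a) * partialSum X (n + 1) ω + a * X (n + 1) ω) ^ 2 ∂μ
        ≤ ∫ ω, (W ω ^ 2 + 2 * (W ω * X (n + 1) ω - W ω * (a * X n ω)) + 4) ∂μ := by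
          refine integral_mono_ae (hWL (n + 1) (by omega)).integrable_sq
            (hi₅.add (integrable_const 4)) ?_
          filter_upwards [hval n hn, hval (n + 1) (by omega)] with ω h h'
          have hstep : (X (n + 1) ω - a * X n ω) ^ 2 ≤ 4 := by
            rcases h with h | h <;> rcases h' with h' | h' <;> rw [h, h'] <;> nlinarith
          rw [partialSum_succ]
          simp only [hW]
          linarith
      _ = ∫ ω, W ω ^ 2 ∂μ + 4 := by
          rw [integral_add hi₅ (integrable_const 4), integral_add hi₁ hi₄, integral_const_mul,
            integral_sub hi₂ hi₃, horth]
          simp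
      _ ≤ 4 * (n + 1 : ℕ) := by
          push_cast
          linarith

lemma integral_partialSum_sq_le (ha : |a| ≤ 1) (ha1 : a ≠ 1) (hXmeas : ∀ i, Measurable (X i))
    (hval : ∀ i, 1 ≤ i → ∀ᵐ ω ∂μ, X i ω = 1 ∨ X i ω = -1)
    (hX : ∀ i, 1 ≤ i → MemLp (X i) 2 μ)
    (hcond : ∀ n, 1 ≤ n → μ[X (n + 1) | sigmaUpTo X n] =ᵐ[μ] fun ω => a * X n ω)
    {n : ℕ} (hn : 1 ≤ n) :
    ∫ ω, partialSum X n ω ^ 2 ∂μ ≤ 10 / (1 - a) ^ 2 * n := by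
  have hW : MemLp (fun ω => (1 - a) * partialSum X n ω + a * X n ω) 2 μ :=
    ((memLp_partialSum hX n).const_mul _).add ((hX n hn).const_mul _)
  have hpos : 0 < (1 - a) ^ 2 := by
    have := sub_ne_zero.2 ha1.symm
    positivity
  have hn' : (1 : ℝ) ≤ n := by exact_mod_cast hn
  have hle : ∫ ω, (1 - a) ^ 2 * partialSum X n ω ^ 2 ∂μ
      ≤ ∫ ω, (2 * ((1 - a) * partialSum X n ω + a * X n ω) ^ 2 + 2) ∂μ := by
    refine integral_mono_ae ((memLp_partialSum hX n).integrable_sq.const_mul _)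
      ((hW.integrable_sq.const_mul 2).add (integrable_const 2)) ?_
    filter_upwards [hval n hn] with ω h
    have hXsq : X n ω ^ 2 = 1 := by rcases h with h | h <;> simp [h]
    have ha2 : a ^ 2 ≤ 1 := (sq_le_one_iff_abs_le_one a).2 ha
    have : (a * X n ω) ^ 2 ≤ 1 := by rw [mul_pow, hXsq, mul_one]; exact ha2
    nlinarith [sq_nonneg ((1 - a) * partialSum X n ω + 2 * (a * X n ω))]
  rw [integral_const_mul, integral_add (hW.integrable_sq.const_mul 2) (integrable_const 2),
    integral_const_mul] at hle
  have h4 := integral_martingale_sq_le ha hXmeas hval hX hcond hn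
  simp only [integral_const, probReal_univ, smul_eq_mul, one_mul] at hle
  rw [div_mul_eq_mul_div, le_div_iff₀ hpos]
  linarith

end LastStepWalk

/-- for the elephant random walk remembering only the most recent step
(with arbitrary `{-1,+1}`-valued first step), the strong law of large numbers holds:
`Sₙ/n → 0` a.s. -/
theorem elephant_last_step_slln
    {Ω : Type*} [MeasurableSpace Ω] (μ : Measure Ω) [IsProbabilityMeasure μ]
    (p : ℝ) (hp0 : 0 < p) (hp1 : p < 1)
    (X : ℕ → Ω → ℝ)
    (hXmeas : ∀ i, Measurable (X i))
    (hval : ∀ i, 1 ≤ i → ∀ᵐ ω ∂μ, X i ω = 1 ∨ X i ω = -1)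
    (hcond : ∀ n, 1 ≤ n →
      μ[X (n+1) | sigmaUpTo X n] =ᵐ[μ] fun ω => (2*p-1) * X n ω) :
    ∀ᵐ ω ∂μ, Tendsto (fun n : ℕ => partialSum X n ω / n) atTop (𝓝 0) := by
  have ha : |2 * p - 1| ≤ 1 := abs_le.2 ⟨by linarith, by linarith⟩
  have hX (i : ℕ) (hi : 1 ≤ i) : MemLp (X i) 2 μ := by
    refine MemLp.of_bound (hXmeas i).aestronglyMeasurable 1 ?_
    filter_upwards [hval i hi] with ω h
    rcases h with h | h <;> simp [h]
  have hlim : ∀ᵐ ω ∂μ, Tendsto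
      (fun k : ℕ => (partialSum X ((k + 1) ^ 2) ω / ((k + 1) ^ 2 : ℕ)) ^ 2) atTop (𝓝 0) := by
    refine ae_tendsto_zero_of_summable_integral
      (b := fun k : ℕ => 10 / (1 - (2 * p - 1)) ^ 2 * (1 / ((k + 1 : ℕ) : ℝ) ^ 2))
      (fun k => ?_) (fun _ _ => sq_nonneg _) (fun k => ?_) ?_ (fun k => ?_)
    · exact ((Finset.measurable_fun_sum _ fun i _ => hXmeas i).div_const _).pow_const 2
    · simp only [div_pow]
      exact (memLp_partialSum hX _).integrable_sq.div_const _
    · exact ((summable_nat_add_iff 1).2 (Real.summable_one_div_nat_pow.2 one_lt_two)).mul_left _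
    · simp only [div_pow]
      rw [integral_div, div_le_iff₀ (by positivity)]
      refine (integral_partialSum_sq_le ha (by linarith) hXmeas hval hX hcond
        (Nat.one_le_pow _ _ k.succ_pos)).trans_eq ?_
      have : ((k : ℝ) + 1) ≠ 0 := by positivity
      push_cast
      field_simp
  filter_upwards [hlim, ae_all_iff.2 fun i => ae_all_iff.2 (hval i)] with ω h hω
  refine tendsto_partialSum_div (fun i hi => ?_) h
  rcases hω i hi with h | h <;> norm_num [h]
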